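/- (Elsässer decomposition of the LAMHD-α subgrid stress divergence.) Let u_s, B_s : ℝ³ → ℝ³ be smooth vector fields with div u_s = 0 and div B_s = 0 everywhere, and set z_s⁺ = u_s + B_s, z_s⁻ = u_s − B_s. Define τ = ( ∇u_s·∇u_s + ∇u_s·(∇u_s)ᵀ − (∇u_s)ᵀ·∇u_s ) − ( ∇B_s·∇B_s + ∇B_s·(∇B_s)ᵀ − (∇B_s)ᵀ·∇B_s ), the symmetric and antisymmetric parts Σ± = ½(∇z_s± + (∇z_s±)ᵀ) and Δ± = ½(∇z_s± − (∇z_s±)ᵀ), and the scalar field Π = ½ tr(∇u_s·∇u_s) − ½ tr(∇B_s·∇B_s). Then at every point of ℝ³, div τ = 2 div( Δ⁺·Σ⁻ + Δ⁻·Σ⁺ ) + ∇Π. -/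

import Mathlib

open Matrix MeasureTheory

noncomputable section

abbrev V3 := Fin 3 → ℝ

/-- Partial derivative `∂_j f` of a scalar field on ℝ³. -/
def pd (j : Fin 3) (f : V3 → ℝ) (x : V3) : ℝ := fderiv ℝ f x (Pi.single j 1)

/-- Jacobian matrix field: `(∇f)_{ij} = ∂f_i/∂x_j`. -/
def grad (f : V3 → V3) (x : V3) : Matrix (Fin 3) (Fin 3) ℝ :=
  Matrix.of fun i j => pd j (fun y => f y i) x

/-- Divergence of a vector field. -/
def divV (f : V3 → V3) (x : V3) : ℝ := ∑ j, pd j (fun y => f y j) x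

/-- Divergence of a matrix field: `(div M)_i = Σ_j ∂_j M_{ij}`. -/
def divM (M : V3 → Matrix (Fin 3) (Fin 3) ℝ) (x : V3) (i : Fin 3) : ℝ :=
  ∑ j, pd j (fun y => M y i j) x

/-- Scalar Laplacian. -/
def lapS (φ : V3 → ℝ) (x : V3) : ℝ := ∑ j, pd j (fun y => pd j φ y) x

/-- Componentwise Laplacian of a vector field. -/
def lap (f : V3 → V3) (x : V3) (i : Fin 3) : ℝ := lapS (fun y => f y i) x

/-- Helmholtz operator `(1 - α²Δ)` on vector fields. -/
def helm (α : ℝ) (f : V3 → V3) (x : V3) (i : Fin 3) : ℝ := f x i - α ^ 2 * lap f x i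

/-- Helmholtz operator `(1 - α²Δ)` on scalar fields. -/
def helmS (α : ℝ) (φ : V3 → ℝ) (x : V3) : ℝ := φ x - α ^ 2 * lapS φ x

/-- Advection `(g·∇)f = Σ_j g_j ∂_j f`. -/
def advect (g f : V3 → V3) (x : V3) (i : Fin 3) : ℝ :=
  ∑ j, g x j * pd j (fun y => f y i) x

/-- `(∇f)ᵀ·g`, pointwise matrix-vector product. -/
def gradTvec (f g : V3 → V3) (x : V3) (i : Fin 3) : ℝ :=
  ∑ j, (grad f x)ᵀ i j * g x j

/-- Gradient of a scalar field. -/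
def gradS (φ : V3 → ℝ) (x : V3) (i : Fin 3) : ℝ := pd i φ x

/-- Pointwise squared Euclidean norm `|f|²`. -/
def normSq (f : V3 → V3) (x : V3) : ℝ := ∑ i, (f x i) ^ 2

/-- Squared Frobenius norm of the Jacobian, `|∇f|²`. -/
def gradNormSq (f : V3 → V3) (x : V3) : ℝ := ∑ i, ∑ j, (grad f x i j) ^ 2

theorem pd_add {f g : V3 → ℝ} (hf : Differentiable ℝ f) (hg : Differentiable ℝ g)
    (j : Fin 3) (x : V3) : pd j (fun y => f y + g y) x = pd j f x + pd j g x := by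
  simp only [pd]
  rw [fderiv_fun_add (hf x) (hg x)]
  rfl

theorem pd_sub {f g : V3 → ℝ} (hf : Differentiable ℝ f) (hg : Differentiable ℝ g)
    (j : Fin 3) (x : V3) : pd j (fun y => f y - g y) x = pd j f x - pd j g x := by
  simp only [pd]
  rw [fderiv_fun_sub (hf x) (hg x)]
  rfl

theorem pd_const_mul {f : V3 → ℝ} (hf : Differentiable ℝ f) (c : ℝ)
    (j : Fin 3) (x : V3) : pd j (fun y => c * f y) x = c * pd j f x := by
  simp only [pd]
  rw [fderiv_const_mul (hf x)]
  rfl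

theorem pd_mul {f g : V3 → ℝ} (hf : Differentiable ℝ f) (hg : Differentiable ℝ g)
    (j : Fin 3) (x : V3) :
    pd j (fun y => f y * g y) x = f x * pd j g x + g x * pd j f x := by
  simp only [pd]
  rw [fderiv_fun_mul (hf x) (hg x)]
  rfl

theorem pd_sum {f : Fin 3 → V3 → ℝ} (hf : ∀ k, Differentiable ℝ (f k))
    (j : Fin 3) (x : V3) : pd j (fun y => ∑ k, f k y) x = ∑ k, pd j (f k) x := by
  simp only [pd]
  rw [fderiv_fun_sum fun k _ => hf k x]
  simp

theorem differentiable_pd {f : V3 → ℝ} (hf : ContDiff ℝ 2 f) (j : Fin 3) :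
    Differentiable ℝ (pd j f) :=
  ((hf.fderiv_right (m := 1) (by norm_num)).differentiable (by norm_num)).clm_apply
    (differentiable_const _)

/-- Second partial derivatives commute. -/
theorem pd_comm {f : V3 → ℝ} (hf : ContDiff ℝ 2 f) (i j : Fin 3) (x : V3) :
    pd i (pd j f) x = pd j (pd i f) x := by
  have hd : DifferentiableAt ℝ (fderiv ℝ f) x :=
    (hf.fderiv_right (m := 1) (by norm_num)).differentiable (by norm_num) x
  have key (k l : Fin 3) : pd k (pd l f) x
      = fderiv ℝ (fderiv ℝ f) x (Pi.single k 1) (Pi.single l 1) := by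
    change fderiv ℝ (fun y => fderiv ℝ f y (Pi.single l 1)) x (Pi.single k 1) = _
    rw [fderiv_clm_apply hd (differentiableAt_const _)]
    simp
  rw [key, key]
  exact (hf.contDiffAt.isSymmSndFDerivAt (by simp)).eq _ _

theorem differentiable_grad_apply {f : V3 → V3} (hf : ContDiff ℝ 2 f) (i j : Fin 3) :
    Differentiable ℝ (fun y => grad f y i j) :=
  differentiable_pd (contDiff_pi.1 hf i) j

theorem divM_add {M N : V3 → Matrix (Fin 3) (Fin 3) ℝ}
    (hM : ∀ i j, Differentiable ℝ fun y => M y i j)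
    (hN : ∀ i j, Differentiable ℝ fun y => N y i j) (x : V3) (i : Fin 3) :
    divM (fun y => M y + N y) x i = divM M x i + divM N x i := by
  simp only [divM, Matrix.add_apply, ← Finset.sum_add_distrib]
  exact Finset.sum_congr rfl fun j _ => pd_add (hM i j) (hN i j) j x

theorem divM_sub {M N : V3 → Matrix (Fin 3) (Fin 3) ℝ}
    (hM : ∀ i j, Differentiable ℝ fun y => M y i j)
    (hN : ∀ i j, Differentiable ℝ fun y => N y i j) (x : V3) (i : Fin 3) :
    divM (fun y => M y - N y) x i = divM M x i - divM N x i := by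
  simp only [divM, Matrix.sub_apply, ← Finset.sum_sub_distrib]
  exact Finset.sum_congr rfl fun j _ => pd_sub (hM i j) (hN i j) j x

theorem divM_smul {M : V3 → Matrix (Fin 3) (Fin 3) ℝ}
    (hM : ∀ i j, Differentiable ℝ fun y => M y i j) (c : ℝ) (x : V3) (i : Fin 3) :
    divM (fun y => c • M y) x i = c * divM M x i := by
  simp only [divM, Matrix.smul_apply, smul_eq_mul, Finset.mul_sum]
  exact Finset.sum_congr rfl fun j _ => pd_const_mul (hM i j) c j x

theorem differentiable_mul_apply {M N : V3 → Matrix (Fin 3) (Fin 3) ℝ}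
    (hM : ∀ i j, Differentiable ℝ fun y => M y i j)
    (hN : ∀ i j, Differentiable ℝ fun y => N y i j) (i j : Fin 3) :
    Differentiable ℝ fun y => (M y * N y) i j := by
  simp only [Matrix.mul_apply]
  exact Differentiable.fun_sum fun k _ => (hM i k).mul (hN k j)

theorem grad_add {f g : V3 → V3} (hf : ContDiff ℝ 2 f) (hg : ContDiff ℝ 2 g) (x : V3) :
    grad (fun z j => f z j + g z j) x = grad f x + grad g x := by
  ext i j
  exact pd_add ((contDiff_pi.1 hf i).differentiable (by norm_num))
    ((contDiff_pi.1 hg i).differentiable (by norm_num)) j x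

theorem grad_sub {f g : V3 → V3} (hf : ContDiff ℝ 2 f) (hg : ContDiff ℝ 2 g) (x : V3) :
    grad (fun z j => f z j - g z j) x = grad f x - grad g x := by
  ext i j
  exact pd_sub ((contDiff_pi.1 hf i).differentiable (by norm_num))
    ((contDiff_pi.1 hg i).differentiable (by norm_num)) j x

theorem differentiable_trace_grad_mul_grad {f : V3 → V3} (hf : ContDiff ℝ 2 f) :
    Differentiable ℝ fun y => Matrix.trace (grad f y * grad f y) := by
  simp only [Matrix.trace, Matrix.diag_apply]
  exact Differentiable.fun_sum fun k _ =>
    differentiable_mul_apply (differentiable_grad_apply hf) (differentiable_grad_apply hf) k k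

/-- For a divergence-free field, `div ((∇f)ᵀ·(∇f)ᵀ) = ½ ∇ tr(∇f·∇f)`. -/
theorem divM_grad_transpose_mul_self {f : V3 → V3} (hf : ContDiff ℝ 2 f)
    (hdiv : ∀ x, divV f x = 0) (x : V3) (i : Fin 3) :
    divM (fun y => (grad f y)ᵀ * (grad f y)ᵀ) x i
      = (1 / 2) * gradS (fun y => Matrix.trace (grad f y * grad f y)) x i := by
  have hg := differentiable_grad_apply hf
  have hcomm (i j k : Fin 3) :
      pd j (fun y => grad f y i k) x = pd k (fun y => grad f y i j) x :=
    pd_comm (contDiff_pi.1 hf i) j k x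
  have hdiv' (k : Fin 3) : ∑ j, pd j (fun y => grad f y j k) x = 0 := by
    simp only [fun j => hcomm j j k]
    rw [← pd_sum fun j => hg j j]
    have h0 : (fun y => ∑ j, grad f y j j) = fun _ => 0 := funext hdiv
    rw [h0]
    simp [pd]
  simp only [divM, gradS, Matrix.trace, Matrix.diag_apply, Matrix.mul_apply,
    Matrix.transpose_apply]
  have hp (a b c d : Fin 3) : Differentiable ℝ fun y => grad f y a b * grad f y c d :=
    (hg a b).fun_mul (hg c d)
  rw [pd_sum fun k => Differentiable.fun_sum fun l _ => hp k l l k]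
  simp only [fun j => pd_sum (fun k => hp k i j k) j x,
    fun k => pd_sum (fun l => hp k l l k) i x, pd_mul (hg _ _) (hg _ _),
    Finset.sum_add_distrib]
  have h1 : ∑ j, ∑ k, grad f x k i * pd j (fun y => grad f y j k) x = 0 := by
    rw [Finset.sum_comm]
    simp only [← Finset.mul_sum, hdiv', mul_zero, Finset.sum_const_zero]
  have h2 : ∑ k, ∑ l, grad f x k l * pd i (fun y => grad f y l k) x
      = ∑ j, ∑ k, grad f x j k * pd j (fun y => grad f y k i) x :=
    Finset.sum_congr rfl fun k _ => Finset.sum_congr rfl fun l _ => by rw [hcomm l i k]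
  have h3 : ∑ k, ∑ l, grad f x l k * pd i (fun y => grad f y k l) x
      = ∑ j, ∑ k, grad f x j k * pd j (fun y => grad f y k i) x := by
    rw [← h2, Finset.sum_comm]
  rw [h1, h2, h3]
  ring

/-- The stress and its Elsässer form differ by `(∇f)ᵀ·(∇f)ᵀ` terms. -/
theorem stress_eq_elsasser (A B : Matrix (Fin 3) (Fin 3) ℝ) :
    (A * A + A * Aᵀ - Aᵀ * A) - (B * B + B * Bᵀ - Bᵀ * B)
      = (2 : ℝ) • (((1 / 2 : ℝ) • ((A + B) - (A + B)ᵀ)) * ((1 / 2 : ℝ) • ((A - B) + (A - B)ᵀ))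
          + ((1 / 2 : ℝ) • ((A - B) - (A - B)ᵀ)) * ((1 / 2 : ℝ) • ((A + B) + (A + B)ᵀ)))
        + (Aᵀ * Aᵀ - Bᵀ * Bᵀ) := by
  simp only [Matrix.transpose_add, Matrix.transpose_sub, smul_mul_assoc, mul_smul_comm,
    ← smul_add, smul_smul]
  norm_num
  simp only [mul_add, add_mul, mul_sub, sub_mul]
  module

/-- Elsässer decomposition of the LAMHD-α subgrid stress divergence,
`div τ = 2 div(Δ⁺·Σ⁻ + Δ⁻·Σ⁺) + ∇Π` with `z_s± = u_s ± B_s`. -/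
theorem lamhd_stress_decomposition_elsasser (us Bs : V3 → V3)
    (hus : ContDiff ℝ (⊤ : ℕ∞) us) (hBs : ContDiff ℝ (⊤ : ℕ∞) Bs)
    (hdivu : ∀ x : V3, divV us x = 0) (hdivB : ∀ x : V3, divV Bs x = 0) :
    ∀ x : V3, ∀ i : Fin 3,
      divM (fun y =>
          (grad us y * grad us y + grad us y * (grad us y)ᵀ - (grad us y)ᵀ * grad us y)
          - (grad Bs y * grad Bs y + grad Bs y * (grad Bs y)ᵀ - (grad Bs y)ᵀ * grad Bs y)) x i
        = 2 * divM (fun y =>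
              ((1 / 2 : ℝ) • (grad (fun z j => us z j + Bs z j) y - (grad (fun z j => us z j + Bs z j) y)ᵀ))
                * ((1 / 2 : ℝ) • (grad (fun z j => us z j - Bs z j) y + (grad (fun z j => us z j - Bs z j) y)ᵀ))
              + ((1 / 2 : ℝ) • (grad (fun z j => us z j - Bs z j) y - (grad (fun z j => us z j - Bs z j) y)ᵀ))
                * ((1 / 2 : ℝ) • (grad (fun z j => us z j + Bs z j) y + (grad (fun z j => us z j + Bs z j) y)ᵀ))) x i
          + gradS (fun y => (1 / 2) * Matrix.trace (grad us y * grad us y)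
              - (1 / 2) * Matrix.trace (grad Bs y * grad Bs y)) x i := by
  intro x i
  have hu : ContDiff ℝ 2 us := contDiff_infty.1 hus 2
  have hB : ContDiff ℝ 2 Bs := contDiff_infty.1 hBs 2
  have hgu := differentiable_grad_apply hu
  have hgB := differentiable_grad_apply hB
  have hTu := differentiable_mul_apply (M := fun y => (grad us y)ᵀ) (N := fun y => (grad us y)ᵀ)
    (fun i j => hgu j i) (fun i j => hgu j i)
  have hTB := differentiable_mul_apply (M := fun y => (grad Bs y)ᵀ) (N := fun y => (grad Bs y)ᵀ)
    (fun i j => hgB j i) (fun i j => hgB j i)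
  simp only [stress_eq_elsasser, grad_add hu hB, grad_sub hu hB]
  have hE : ∀ i j, Differentiable ℝ fun y =>
      (((1 / 2 : ℝ) • ((grad us y + grad Bs y) - (grad us y + grad Bs y)ᵀ))
          * ((1 / 2 : ℝ) • ((grad us y - grad Bs y) + (grad us y - grad Bs y)ᵀ))
        + ((1 / 2 : ℝ) • ((grad us y - grad Bs y) - (grad us y - grad Bs y)ᵀ))
          * ((1 / 2 : ℝ) • ((grad us y + grad Bs y) + (grad us y + grad Bs y)ᵀ))) i j := by
    intro i j
    simp only [Matrix.add_apply, Matrix.mul_apply, Matrix.smul_apply, Matrix.sub_apply,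
      Matrix.transpose_apply, smul_eq_mul]
    fun_prop
  rw [divM_add (M := fun y => (2 : ℝ) • _) (N := fun y => _ - _)
      (fun i j => (hE i j).const_mul 2) (fun i j => (hTu i j).fun_sub (hTB i j)),
    divM_smul hE, divM_sub hTu hTB, divM_grad_transpose_mul_self hu hdivu,
    divM_grad_transpose_mul_self hB hdivB]
  have htu := differentiable_trace_grad_mul_grad hu
  have htB := differentiable_trace_grad_mul_grad hB
  simp only [gradS]
  rw [pd_sub (htu.const_mul _) (htB.const_mul _), pd_const_mul htu, pd_const_mul htB]
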